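/- arXiv:2411.14142 — 2 statements merged into one kernel-verified Lean document; each statement's English description precedes it below -/
import Mathlib

section
/- Let R be a commutative ring and S a multiplicative subset of R. The following are equivalent: (1) R is an S-coherent ring; (2) any s-pure quotient of an s-absolutely pure R-module is s-absolutely pure; (3) any pure quotient of an s-absolutely pure R-module is s-absolutely pure; (4) any pure quotient of an absolutely pure R-module is s-absolutely pure; (5) any direct limit of a direct system of absolutely pure R-modules is s-absolutely pure. -/
open CategoryTheory TensorProduct

universe u

variable {R : Type u} [CommRing R]

/-- `Tor₁^R(M, N)` as an object of `ModuleCat R`, via the derived tensor product. -/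
noncomputable abbrev Tor1 (R : Type u) [CommRing R] (M N : Type u)
    [AddCommGroup M] [Module R M] [AddCommGroup N] [Module R N] : ModuleCat.{u} R :=
  ((Tor (ModuleCat.{u} R) 1).obj (ModuleCat.of R M)).obj (ModuleCat.of R N)

/-- `Ext¹_R(M, N)` as an object of `ModuleCat R`. -/
noncomputable abbrev Ext1 (R : Type u) [CommRing R] (M N : Type u)
    [AddCommGroup M] [Module R M] [AddCommGroup N] [Module R N] : ModuleCat.{u} R :=
  ((Ext R (ModuleCat.{u} R) 1).obj (Opposite.op (ModuleCat.of R M))).obj (ModuleCat.of R N)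

/-- u-S-exactness at the middle spot of `A →f B →g C`, with respect to a given `s`:
`s • ker g ⊆ im f` and `s • im f ⊆ ker g`. -/
def IsUSExactAtWith (s : R) {A B C : Type u} [AddCommGroup A] [Module R A]
    [AddCommGroup B] [Module R B] [AddCommGroup C] [Module R C]
    (f : A →ₗ[R] B) (g : B →ₗ[R] C) : Prop :=
  (∀ x ∈ LinearMap.ker g, s • x ∈ LinearMap.range f) ∧
  (∀ x ∈ LinearMap.range f, s • x ∈ LinearMap.ker g)

/-- The sequence `0 → A →f B →g C → 0` is u-S-exact with respect to the single element `s`. -/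
def ShortUSExactWith (s : R) {A B C : Type u} [AddCommGroup A] [Module R A]
    [AddCommGroup B] [Module R B] [AddCommGroup C] [Module R C]
    (f : A →ₗ[R] B) (g : B →ₗ[R] C) : Prop :=
  (∀ x ∈ LinearMap.ker f, s • x = (0 : A)) ∧ IsUSExactAtWith s f g ∧
    (∀ c : C, s • c ∈ LinearMap.range g)

/-- The sequence `0 → A →f B →g C → 0` is u-S-exact (at every place, with possibly
different witnesses `s ∈ S`). -/
def ShortUSExact (S : Submonoid R) {A B C : Type u} [AddCommGroup A] [Module R A]
    [AddCommGroup B] [Module R B] [AddCommGroup C] [Module R C]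
    (f : A →ₗ[R] B) (g : B →ₗ[R] C) : Prop :=
  (∃ s ∈ S, ∀ x ∈ LinearMap.ker f, s • x = (0 : A)) ∧
  (∃ s ∈ S, IsUSExactAtWith s f g) ∧
  (∃ s ∈ S, ∀ c : C, s • c ∈ LinearMap.range g)

/-- A short exact sequence `0 → A →f B →g C → 0` is s-pure if tensoring it with every
finitely presented module yields a u-S-exact sequence. -/
def SPure (S : Submonoid R) {A B C : Type u} [AddCommGroup A] [Module R A]
    [AddCommGroup B] [Module R B] [AddCommGroup C] [Module R C]
    (f : A →ₗ[R] B) (g : B →ₗ[R] C) : Prop :=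
  ∀ (M : Type u) [AddCommGroup M] [Module R M], Module.FinitePresentation R M →
    ShortUSExact S (LinearMap.lTensor M f) (LinearMap.lTensor M g)

/-- A short exact sequence `0 → A →f B →g C → 0` is pure if tensoring it with every
finitely presented module yields an exact sequence `0 → M⊗A → M⊗B → M⊗C → 0`. -/
def IsPureSES {A B C : Type u} [AddCommGroup A] [Module R A]
    [AddCommGroup B] [Module R B] [AddCommGroup C] [Module R C]
    (f : A →ₗ[R] B) (g : B →ₗ[R] C) : Prop :=
  ∀ (M : Type u) [AddCommGroup M] [Module R M], Module.FinitePresentation R M →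
    Function.Injective (LinearMap.lTensor M f) ∧
    Function.Exact (LinearMap.lTensor M f) (LinearMap.lTensor M g) ∧
    Function.Surjective (LinearMap.lTensor M g)

/-- An `R`-module `F` is s-flat if for every finitely presented `M` there is `s ∈ S`
with `s • Tor₁(M, F) = 0`. -/
def IsSFlat (S : Submonoid R) (F : Type u) [AddCommGroup F] [Module R F] : Prop :=
  ∀ (M : Type u) [AddCommGroup M] [Module R M], Module.FinitePresentation R M →
    ∃ s ∈ S, ∀ x : Tor1 R M F, s • x = 0

/-- An `R`-module `E` is s-absolutely pure if for every finitely presented `N` there is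
`s ∈ S` with `s • Ext¹(N, E) = 0`. -/
def IsSAbsolutelyPure (S : Submonoid R) (E : Type u) [AddCommGroup E] [Module R E] : Prop :=
  ∀ (N : Type u) [AddCommGroup N] [Module R N], Module.FinitePresentation R N →
    ∃ s ∈ S, ∀ x : Ext1 R N E, s • x = 0

/-- An `R`-module `E` is absolutely pure if `Ext¹(N, E) = 0` for every finitely
presented `N`. -/
def IsAbsolutelyPure (R : Type u) [CommRing R] (E : Type u)
    [AddCommGroup E] [Module R E] : Prop :=
  ∀ (N : Type u) [AddCommGroup N] [Module R N], Module.FinitePresentation R N →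
    ∀ x : Ext1 R N E, x = 0

/-- An injective cogenerator in the category of `R`-modules: an injective module `E`
such that `Hom_R(M, E) = 0` implies `M = 0`. -/
def IsInjectiveCogenerator (R : Type u) [CommRing R] (E : Type u)
    [AddCommGroup E] [Module R E] : Prop :=
  Module.Injective R E ∧
    ∀ (M : Type u) [AddCommGroup M] [Module R M], (∀ φ : M →ₗ[R] E, φ = 0) → Subsingleton M

/-- An `R`-module `M` is `S`-finite if `s • M ⊆ K` for some `s ∈ S` and some finitely
generated submodule `K` of `M`. -/
def IsSFinite (S : Submonoid R) (M : Type u) [AddCommGroup M] [Module R M] : Prop :=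
  ∃ s ∈ S, ∃ K : Submodule R M, K.FG ∧ ∀ m : M, s • m ∈ K

/-- An `R`-module `M` is `S`-finitely presented if there is an exact sequence
`0 → K → F → M → 0` with `F` finitely generated free and `K` `S`-finite. -/
def IsSFinitelyPresented (S : Submonoid R) (M : Type u) [AddCommGroup M] [Module R M] : Prop :=
  ∃ (n : ℕ) (π : (Fin n → R) →ₗ[R] M), Function.Surjective π ∧
    IsSFinite S ↥(LinearMap.ker π)

/-- `R` is an `S`-coherent ring if every finitely generated ideal of `R` is
`S`-finitely presented. -/
def IsSCoherentRing (S : Submonoid R) : Prop :=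
  ∀ I : Ideal R, I.FG → IsSFinitelyPresented S ↥I

theorem linearEquiv_smul_eq_zero_iff {M N : Type u} [AddCommGroup M] [Module R M]
    [AddCommGroup N] [Module R N] (e : M ≃ₗ[R] N) (s : R) :
    (∀ x : M, s • x = 0) ↔ ∀ x : N, s • x = 0 := by
  constructor
  · intro h x
    simpa using congrArg e (h (e.symm x))
  · intro h x
    apply e.injective
    simpa using h (e x)

theorem shortComplex_homology_smul_eq_zero_iff (T : ShortComplex (ModuleCat.{u} R)) (s : R) :
    (∀ x : T.homology, s • x = 0) ↔ ∀ z : T.X₂, T.g z = 0 → ∃ y : T.X₁, T.f y = s • z := by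
  have e : T.homology ≃ₗ[R] (LinearMap.ker T.g.hom ⧸ LinearMap.range T.moduleCatToCycles) :=
    T.moduleCatHomologyIso.toLinearEquiv
  rw [linearEquiv_smul_eq_zero_iff e s]
  constructor
  · intro h z hz
    have h1 := h (Submodule.Quotient.mk ⟨z, hz⟩)
    rw [← Submodule.Quotient.mk_smul, Submodule.Quotient.mk_eq_zero] at h1
    obtain ⟨y, hy⟩ := h1
    exact ⟨y, congrArg Subtype.val hy⟩
  · intro h x
    obtain ⟨⟨z, hz⟩, rfl⟩ := Submodule.Quotient.mk_surjective _ x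
    rw [← Submodule.Quotient.mk_smul, Submodule.Quotient.mk_eq_zero]
    obtain ⟨y, hy⟩ := h z hz
    exact ⟨y, Subtype.ext hy⟩

theorem ext_smul_eq_zero_iff_of_resolution {N : ModuleCat.{u} R} (P : ProjectiveResolution N)
    (E : ModuleCat.{u} R) (s : R) :
    (∀ x : ((Ext R (ModuleCat.{u} R) 1).obj (Opposite.op N)).obj E, s • x = 0) ↔
      ∀ z : P.complex.X 1 ⟶ E, P.complex.d 2 1 ≫ z = 0 →
        ∃ y : P.complex.X 0 ⟶ E, P.complex.d 1 0 ≫ y = s • z := by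
  rw [linearEquiv_smul_eq_zero_iff (P.isoExt 1 E ≪≫
    (ShortComplex.homologyMapIso ((P.complex.linearYonedaObj R E).isoSc' 0 1 2
      (by simp) (by simp)))).toLinearEquiv s, shortComplex_homology_smul_eq_zero_iff]
  rfl

theorem exists_comp_eq_of_ker_le {A B C : Type*} [AddCommGroup A] [Module R A]
    [AddCommGroup B] [Module R B] [AddCommGroup C] [Module R C] {q : A →ₗ[R] B}
    (hq : Function.Surjective q) (f : A →ₗ[R] C) (h : ∀ x, q x = 0 → f x = 0) :
    ∃ g : B →ₗ[R] C, ∀ x, g (q x) = f x := by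
  refine ⟨(LinearMap.ker q).liftQ f h ∘ₗ (q.quotKerEquivOfSurjective hq).symm.toLinearMap,
    fun x => ?_⟩
  have : (q.quotKerEquivOfSurjective hq).symm (q x) = (LinearMap.ker q).mkQ x := by
    rw [LinearEquiv.symm_apply_eq]
    rfl
  rw [LinearMap.comp_apply, LinearEquiv.coe_coe, this]
  exact Submodule.liftQ_apply _ _ _

/-- Every linear map from the submodule `K` to `E` extends to the ambient module after
multiplication by `s`. -/
def SmulExtends (s : R) {P : Type*} (E : Type*) [AddCommGroup P] [Module R P]
    [AddCommGroup E] [Module R E] (K : Submodule R P) : Prop :=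
  ∀ φ : K →ₗ[R] E, ∃ ψ : P →ₗ[R] E, ∀ k : K, ψ k = s • φ k

theorem smulExtends_iff_of_exact (s : R) {X₂ X₁ X₀ N E : Type*} [AddCommGroup X₂] [Module R X₂]
    [AddCommGroup X₁] [Module R X₁] [AddCommGroup X₀] [Module R X₀] [AddCommGroup N] [Module R N]
    [AddCommGroup E] [Module R E] {d₂ : X₂ →ₗ[R] X₁} {d₁ : X₁ →ₗ[R] X₀} {p : X₀ →ₗ[R] N}
    (h₁ : Function.Exact d₂ d₁) (h₀ : Function.Exact d₁ p) :
    SmulExtends s E (LinearMap.ker p) ↔ ∀ z : X₁ →ₗ[R] E, z ∘ₗ d₂ = 0 → ∃ y : X₀ →ₗ[R] E, y ∘ₗ d₁ = s • z := by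
  let d : X₁ →ₗ[R] LinearMap.ker p := d₁.codRestrict _ fun x => (h₀ _).2 ⟨x, rfl⟩
  have hd : Function.Surjective d := fun ⟨k, hk⟩ => by
    obtain ⟨x, hx⟩ := (h₀ _).1 hk
    exact ⟨x, Subtype.ext hx⟩
  constructor
  · intro h z hz
    obtain ⟨φ, hφ⟩ := exists_comp_eq_of_ker_le hd z fun x hx => by
      obtain ⟨w, rfl⟩ := (h₁ x).1 (congrArg Subtype.val hx)
      exact LinearMap.congr_fun hz w
    obtain ⟨ψ, hψ⟩ := h φ
    refine ⟨ψ, LinearMap.ext fun x => ?_⟩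
    have := hψ (d x)
    rw [hφ] at this
    exact this
  · intro h φ
    obtain ⟨y, hy⟩ := h (φ ∘ₗ d) (LinearMap.ext fun w => by
      have : d (d₂ w) = 0 := Subtype.ext ((h₁ _).2 ⟨w, rfl⟩)
      simp [this])
    refine ⟨y, fun k => ?_⟩
    obtain ⟨x, rfl⟩ := hd k
    exact LinearMap.congr_fun hy x

theorem SmulExtends.of_projective {s : R} {P Q N E : Type*} [AddCommGroup P] [Module R P]
    [AddCommGroup Q] [Module R Q] [AddCommGroup N] [Module R N] [AddCommGroup E] [Module R E]
    [Module.Projective R P] [Module.Projective R Q] {p : P →ₗ[R] N} {q : Q →ₗ[R] N}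
    (hp : Function.Surjective p) (hq : Function.Surjective q) (h : SmulExtends s E (LinearMap.ker p)) :
    SmulExtends s E (LinearMap.ker q) := by
  obtain ⟨a, ha⟩ := Module.projective_lifting_property p q hp
  obtain ⟨b, hb⟩ := Module.projective_lifting_property q p hq
  have ha' : ∀ x, p (a x) = q x := LinearMap.congr_fun ha
  have hb' : ∀ x, q (b x) = p x := LinearMap.congr_fun hb
  intro φ
  let b' : LinearMap.ker p →ₗ[R] LinearMap.ker q :=
    b.restrict fun x hx => by simpa [hb'] using hx
  let c : Q →ₗ[R] LinearMap.ker q :=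
    (LinearMap.id - b ∘ₗ a).codRestrict _ fun x => by simp [ha', hb']
  obtain ⟨θ, hθ⟩ := h (φ ∘ₗ b')
  refine ⟨θ ∘ₗ a + s • φ ∘ₗ c, fun k => ?_⟩
  have hk : p (a k) = 0 := by rw [ha']; exact k.2
  have h1 := hθ ⟨a k, hk⟩
  have h2 : b' ⟨a k, hk⟩ + c k = k := Subtype.ext (by simp [b', c])
  calc (θ ∘ₗ a + s • φ ∘ₗ c) k = s • φ (b' ⟨a k, hk⟩) + s • φ (c k) := by
        simp only [LinearMap.add_apply, LinearMap.comp_apply, LinearMap.smul_apply]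
        rw [h1]; rfl
    _ = s • φ k := by rw [← smul_add, ← map_add, h2]

theorem ext1_smul_eq_zero_iff (s : R) {P N E : Type u} [AddCommGroup P] [Module R P]
    [AddCommGroup N] [Module R N] [AddCommGroup E] [Module R E] [Module.Projective R P]
    {p : P →ₗ[R] N} (hp : Function.Surjective p) :
    (∀ x : Ext1 R N E, s • x = 0) ↔ SmulExtends s E (LinearMap.ker p) := by
  let X := ProjectiveResolution.of (ModuleCat.of R N)
  have h₁ : Function.Exact (X.complex.d 2 1).hom (X.complex.d 1 0).hom :=
    (ShortComplex.ShortExact.moduleCat_exact_iff_function_exact _).1 (X.exact_succ 0)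
  have h₀ : Function.Exact (X.complex.d 1 0).hom (X.π.f 0).hom :=
    (ShortComplex.ShortExact.moduleCat_exact_iff_function_exact _).1 X.exact₀
  have hπ : Function.Surjective (X.π.f 0).hom := (ModuleCat.epi_iff_surjective _).1 inferInstance
  have : Module.Projective R (X.complex.X 0) := ModuleCat.projective_of_module_projective _
  have key : SmulExtends s E (LinearMap.ker p) ↔ SmulExtends s E (LinearMap.ker (X.π.f 0).hom) :=
    ⟨fun h => h.of_projective hp hπ, fun h => h.of_projective hπ hp⟩
  rw [key, smulExtends_iff_of_exact s h₁ h₀, ext_smul_eq_zero_iff_of_resolution X]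
  constructor
  · intro h z hz
    obtain ⟨y, hy⟩ := h (ModuleCat.ofHom z) (ModuleCat.hom_ext hz)
    exact ⟨y.hom, congrArg ModuleCat.Hom.hom hy⟩
  · intro h z hz
    obtain ⟨y, hy⟩ := h z.hom (congrArg ModuleCat.Hom.hom hz)
    exact ⟨ModuleCat.ofHom y, ModuleCat.hom_ext hy⟩

theorem isSAbsolutelyPure_iff {S : Submonoid R} {E : Type u} [AddCommGroup E] [Module R E] :
    IsSAbsolutelyPure S E ↔ ∀ (n : ℕ) (K : Submodule R (Fin n → R)), K.FG →
      ∃ s ∈ S, SmulExtends s E K := by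
  constructor
  · intro h n K hK
    obtain ⟨s, hs, hx⟩ := h ((Fin n → R) ⧸ K)
      (Module.finitePresentation_of_surjective K.mkQ K.mkQ_surjective (by simpa using hK))
    refine ⟨s, hs, ?_⟩
    rw [ext1_smul_eq_zero_iff s K.mkQ_surjective, K.ker_mkQ] at hx
    exact hx
  · intro h N _ _ hN
    obtain ⟨n, p, hp⟩ := Module.Finite.exists_fin' R N
    obtain ⟨s, hs, hK⟩ := h n _ (Module.FinitePresentation.fg_ker p hp)
    exact ⟨s, hs, (ext1_smul_eq_zero_iff s hp).2 hK⟩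

theorem isAbsolutelyPure_iff_isSAbsolutelyPure_bot {E : Type u} [AddCommGroup E] [Module R E] :
    IsAbsolutelyPure R E ↔ IsSAbsolutelyPure (⊥ : Submonoid R) E := by
  simp only [IsAbsolutelyPure, IsSAbsolutelyPure, Submonoid.mem_bot, exists_eq_left, one_smul]

theorem IsSAbsolutelyPure.mono {S T : Submonoid R} (hST : S ≤ T) {E : Type u} [AddCommGroup E]
    [Module R E] (h : IsSAbsolutelyPure S E) : IsSAbsolutelyPure T E := fun N _ _ hN =>
  let ⟨s, hs, hx⟩ := h N hN
  ⟨s, hST hs, hx⟩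

theorem isAbsolutelyPure_iff {E : Type u} [AddCommGroup E] [Module R E] :
    IsAbsolutelyPure R E ↔ ∀ (n : ℕ) (K : Submodule R (Fin n → R)), K.FG →
      ∀ φ : K →ₗ[R] E, ∃ ψ : (Fin n → R) →ₗ[R] E, ∀ k : K, ψ k = φ k := by
  rw [isAbsolutelyPure_iff_isSAbsolutelyPure_bot, isSAbsolutelyPure_iff]
  simp [SmulExtends, Submonoid.mem_bot]

theorem IsPureSES.sPure {A B C : Type u} [AddCommGroup A] [Module R A]
    [AddCommGroup B] [Module R B] [AddCommGroup C] [Module R C]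
    {f : A →ₗ[R] B} {g : B →ₗ[R] C} (h : IsPureSES f g) (S : Submonoid R) : SPure S f g := by
  intro M _ _ hM
  obtain ⟨h1, h2, h3⟩ := h M hM
  refine ⟨⟨1, S.one_mem, fun x hx => ?_⟩, ⟨1, S.one_mem, fun x hx => ?_, fun x hx => ?_⟩,
    ⟨1, S.one_mem, fun c => ?_⟩⟩
  · rw [one_smul]
    exact h1 (by simpa using hx)
  · rw [one_smul]
    exact (h2 x).1 hx
  · rw [one_smul]
    exact (h2 x).2 hx
  · exact h3 _

/-- For an s-pure sequence, finite systems of homogeneous equations lift along `g`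
up to some element of `S`. -/
theorem SPure.exists_lift {S : Submonoid R} {A B C : Type u} [AddCommGroup A] [Module R A]
    [AddCommGroup B] [Module R B] [AddCommGroup C] [Module R C]
    {f : A →ₗ[R] B} {g : B →ₗ[R] C}
    (hfg : LinearMap.range f = LinearMap.ker g) (hg : Function.Surjective g) (h : SPure S f g)
    {k m : ℕ} (r : (Fin k → R) →ₗ[R] (Fin m → R)) :
    ∃ t ∈ S, ∀ γ : (Fin m → R) →ₗ[R] C, γ ∘ₗ r = 0 →
      ∃ β : (Fin m → R) →ₗ[R] B, β ∘ₗ r = 0 ∧ g ∘ₗ β = t • γ := by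
  classical
  let D : (Fin m → R) →ₗ[R] (Fin k → R) := Matrix.toLin' (Matrix.of fun i j => r (Pi.single i 1) j)
  let M := (Fin k → R) ⧸ LinearMap.range D
  have hM : Module.FinitePresentation R M :=
    Module.finitePresentation_of_surjective _ (Submodule.mkQ_surjective _)
      (by rw [Submodule.ker_mkQ, LinearMap.range_eq_map]; exact Module.Finite.fg_top.map D)
  obtain ⟨⟨t, ht, hker⟩, -⟩ := h M hM
  refine ⟨t, ht, fun γ hγ => ?_⟩
  obtain ⟨b, hb⟩ := Module.projective_lifting_property g γ hg
  have hmem (i : Fin k) : ∃ a, f a = b (r (Pi.single i 1)) := by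
    change _ ∈ LinearMap.range f
    rw [hfg, LinearMap.mem_ker]
    have := LinearMap.congr_fun hb (r (Pi.single i 1))
    rw [LinearMap.comp_apply] at this
    rw [this]
    exact LinearMap.congr_fun hγ _
  choose a ha using hmem
  let e (i : Fin k) : M := Submodule.Quotient.mk (Pi.single i 1)
  have he : Submodule.span R (Set.range e) = ⊤ := by
    have : Set.range e = (LinearMap.range D).mkQ '' Set.range fun i : Fin k => Pi.single i (1 : R) := by
      rw [← Set.range_comp]; rfl
    rw [this, Submodule.span_image]
    have h2 := (Pi.basisFun R (Fin k)).span_eq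
    have h3 : (fun i : Fin k => (Pi.single i (1 : R) : Fin k → R)) = Pi.basisFun R (Fin k) := by
      ext1 i; simp
    rw [h3, h2, Submodule.map_top, Submodule.range_mkQ]
  have hrel (j : Fin m) : ∑ i, r (Pi.single i 1) j • e i = 0 := by
    have : ∑ i, r (Pi.single i 1) j • e i
        = (LinearMap.range D).mkQ (∑ i, r (Pi.single i 1) j • Pi.single i (1 : R)) := by
      simp [e]
    rw [this, Submodule.mkQ_apply, Submodule.Quotient.mk_eq_zero]
    refine ⟨Pi.single j 1, ?_⟩
    ext i
    simp [D, Finset.sum_apply, Pi.single_apply]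
  have hr (i : Fin k) : r (Pi.single i 1) = ∑ j, r (Pi.single i 1) j • Pi.single j (1 : R) := by
    ext j
    simp [Finset.sum_apply, Pi.single_apply]
  have hz : LinearMap.lTensor M f (∑ i, e i ⊗ₜ[R] a i) = 0 := by
    simp only [map_sum, LinearMap.lTensor_tmul, ha]
    refine TensorProduct.sum_tmul_eq_zero_of_vanishesTrivially R
      ⟨m, fun i j => r (Pi.single i 1) j, fun j => b (Pi.single j 1), fun i => ?_, hrel⟩
    change b (r (Pi.single i 1)) = _
    conv_lhs => rw [hr]
    simp
  have hz' := hker _ hz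
  rw [Finset.smul_sum] at hz'
  simp only [← TensorProduct.tmul_smul] at hz'
  obtain ⟨l, c, y, hy, hc⟩ := TensorProduct.vanishesTrivially_of_sum_tmul_eq_zero R he hz'
  have hc' (j : Fin l) : ∃ d : Fin m → R, D d = fun i => c i j := by
    have h1 := hc j
    have : ∑ i, c i j • e i = (LinearMap.range D).mkQ (fun i => c i j) := by
      rw [← Finset.univ_sum_single (fun i => c i j)]
      simp only [map_sum, e]
      refine Finset.sum_congr rfl fun i _ => ?_
      rw [← Submodule.mkQ_apply, ← map_smul]
      congr 1
      ext i'
      simp [Pi.single_apply]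
    rw [this, Submodule.mkQ_apply, Submodule.Quotient.mk_eq_zero] at h1
    exact h1
  choose d hd using hc'
  let α : (Fin m → R) →ₗ[R] A := ∑ j, (LinearMap.toSpanSingleton R A (y j)) ∘ₗ
    (Fintype.linearCombination R (d j))
  have hα (i : Fin k) : α (r (Pi.single i 1)) = t • a i := by
    refine Eq.trans ?_ (hy i).symm
    simp only [α, LinearMap.sum_apply, LinearMap.comp_apply, LinearMap.toSpanSingleton_apply]
    refine Finset.sum_congr rfl fun j _ => ?_
    congr 1
    have := congrFun (hd j) i
    rw [← this]
    simp [D, mul_comm, Fintype.linearCombination_apply, Matrix.mulVec, dotProduct]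
  refine ⟨t • b - f ∘ₗ α, ?_, ?_⟩
  · refine LinearMap.pi_ext' fun i => LinearMap.ext_ring ?_
    simp [hα, ha]
  · have hgf : g ∘ₗ f = 0 := LinearMap.range_le_ker_iff.1 hfg.le
    rw [LinearMap.comp_sub, ← LinearMap.comp_assoc, hgf, LinearMap.comp_smul, hb]
    simp

theorem exists_sum_tmul_eq {M A : Type*} [AddCommGroup M] [Module R M] [AddCommGroup A]
    [Module R A] {ι : Type*} [Fintype ι] {e : ι → M}
    (he : Submodule.span R (Set.range e) = ⊤) (x : M ⊗[R] A) :
    ∃ a : ι → A, ∑ i, e i ⊗ₜ[R] a i = x := by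
  induction x with
  | zero => exact ⟨0, by simp⟩
  | tmul m a =>
    obtain ⟨c, hc⟩ := (Submodule.mem_span_range_iff_exists_fun R).1
      (he ▸ Submodule.mem_top : m ∈ Submodule.span R (Set.range e))
    exact ⟨fun i => c i • a, by simp [← hc, TensorProduct.sum_tmul, TensorProduct.smul_tmul]⟩
  | add x y hx hy =>
    obtain ⟨a, rfl⟩ := hx
    obtain ⟨b, rfl⟩ := hy
    exact ⟨a + b, by simp [TensorProduct.tmul_add, Finset.sum_add_distrib]⟩

/-- If finite systems of homogeneous equations lift along `g`, the sequence is pure. -/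
theorem IsPureSES.of_exists_lift {A B C : Type u} [AddCommGroup A] [Module R A]
    [AddCommGroup B] [Module R B] [AddCommGroup C] [Module R C]
    {f : A →ₗ[R] B} {g : B →ₗ[R] C} (hf : Function.Injective f)
    (hfg : LinearMap.range f = LinearMap.ker g) (hg : Function.Surjective g)
    (h : ∀ (k m : ℕ) (r : (Fin k → R) →ₗ[R] (Fin m → R)) (γ : (Fin m → R) →ₗ[R] C),
      γ ∘ₗ r = 0 → ∃ β : (Fin m → R) →ₗ[R] B, β ∘ₗ r = 0 ∧ g ∘ₗ β = γ) :
    IsPureSES f g := by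
  intro M _ _ hM
  have hex : Function.Exact f g := LinearMap.exact_iff.2 hfg.symm
  refine ⟨(injective_iff_map_eq_zero _).2 fun x hx => ?_, lTensor_exact M hex hg,
    LinearMap.lTensor_surjective M hg⟩
  obtain ⟨k, e, he⟩ := Module.Finite.exists_fin (R := R) (M := M)
  obtain ⟨a, rfl⟩ := exists_sum_tmul_eq he x
  simp only [map_sum, LinearMap.lTensor_tmul] at hx
  obtain ⟨l, c, y, hy, hc⟩ := TensorProduct.vanishesTrivially_of_sum_tmul_eq_zero R he hx
  let r : (Fin k → R) →ₗ[R] (Fin l → R) := Fintype.linearCombination R c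
  let β₀ : (Fin l → R) →ₗ[R] B := Fintype.linearCombination R y
  have hr (i : Fin k) : β₀ (r (Pi.single i 1)) = f (a i) := by
    simp [r, β₀, hy, Fintype.linearCombination_apply]
  obtain ⟨β, hβ, hgβ⟩ := h k l r (g ∘ₗ β₀) (by
    refine LinearMap.pi_ext' fun i => LinearMap.ext_ring ?_
    simpa [hr] using hex.apply_apply_eq_zero (a i))
  have hmem (j : Fin l) : ∃ a', f a' = y j - β (Pi.single j 1) := by
    change _ ∈ LinearMap.range f
    rw [hfg, LinearMap.mem_ker, map_sub, sub_eq_zero]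
    simpa [β₀] using (LinearMap.congr_fun hgβ (Pi.single j 1)).symm
  choose a' ha' using hmem
  refine TensorProduct.sum_tmul_eq_zero_of_vanishesTrivially R ⟨l, c, a', fun i => hf ?_, hc⟩
  have h0 : ∑ j, c i j • β (Pi.single j 1) = 0 := by
    have h1 := LinearMap.congr_fun hβ (Pi.single i 1)
    have h2 : r (Pi.single i 1) = ∑ j, c i j • Pi.single j (1 : R) := by
      ext j
      simp [r, Finset.sum_apply, Pi.single_apply]
    rw [LinearMap.comp_apply, h2] at h1
    simpa using h1
  simp only [map_sum, map_smul, ha', smul_sub, Finset.sum_sub_distrib, h0, sub_zero]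
  exact hy i

theorem isAbsolutelyPure_directSum {ι : Type u} [DecidableEq ι] {G : ι → Type u}
    [∀ i, AddCommGroup (G i)] [∀ i, Module R (G i)] (h : ∀ i, IsAbsolutelyPure R (G i)) :
    IsAbsolutelyPure R (DirectSum ι G) := by
  classical
  rw [isAbsolutelyPure_iff]
  intro n K hK φ
  obtain ⟨X, hX⟩ : (⊤ : Submodule R K).FG := (Submodule.fg_top K).2 hK
  have hT : ∀ k : K, ∀ i ∉ X.biUnion fun x => DFinsupp.support (φ x), φ k i = 0 := by
    intro k i hi
    have hk : k ∈ Submodule.span R (X : Set K) := hX ▸ Submodule.mem_top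
    induction hk using Submodule.span_induction with
    | mem x hx =>
      by_contra hne
      exact hi (Finset.mem_biUnion.2 ⟨x, hx, DFinsupp.mem_support_iff.2 hne⟩)
    | zero => simp
    | add x y _ _ hx hy => simp [hx, hy]
    | smul c x _ hx => simp [DirectSum.smul_apply, hx]
  generalize X.biUnion (fun x => DFinsupp.support (φ x)) = T at hT
  choose ψ hψ using fun i =>
    isAbsolutelyPure_iff.1 (h i) n K hK (DirectSum.component R ι G i ∘ₗ φ)
  refine ⟨∑ i ∈ T, DirectSum.lof R ι G i ∘ₗ ψ i, fun k => ?_⟩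
  refine DFinsupp.ext fun i => ?_
  rw [LinearMap.sum_apply]
  have : ∀ j, (DirectSum.lof R ι G j ∘ₗ ψ j) (k : Fin n → R) = DirectSum.lof R ι G j (φ k j) :=
    fun j => by rw [LinearMap.comp_apply, hψ]; rfl
  simp only [this]
  change DirectSum.component R ι G i _ = φ k i
  rw [map_sum]
  by_cases hi : i ∈ T
  · rw [Finset.sum_eq_single i]
    · rw [DirectSum.component.lof_self]
    · intro j _ hj
      rw [DirectSum.component.of, dif_neg hj]
    · exact fun h => absurd hi h
  · rw [hT k i hi]
    refine Finset.sum_eq_zero fun j hj => ?_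
    rw [DirectSum.component.of, dif_neg (by rintro rfl; exact hi hj)]

section DirectLimit

variable {ι : Type u} [Preorder ι] [IsDirected ι (· ≤ ·)] [DecidableEq ι]
  {G : ι → Type u} [∀ i, AddCommGroup (G i)] [∀ i, Module R (G i)]
  {f : ∀ i j, i ≤ j → G i →ₗ[R] G j}

theorem directLimit_exists_of_comp_eq [Nonempty ι] {m : ℕ}
    (γ : (Fin m → R) →ₗ[R] Module.DirectLimit G f) :
    ∃ (i : ι) (χ : (Fin m → R) →ₗ[R] G i), Module.DirectLimit.of R ι G f i ∘ₗ χ = γ := by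
  choose i x hx using fun j : Fin m => Module.DirectLimit.exists_of (γ (Pi.single j 1))
  obtain ⟨M, hM⟩ := Finite.exists_le i
  refine ⟨M, Fintype.linearCombination R fun j => f (i j) M (hM j) (x j), ?_⟩
  refine LinearMap.pi_ext' fun j => LinearMap.ext_ring ?_
  simpa using hx j

theorem directLimit_exists_comp_eq_zero [DirectedSystem G (fun i j h => f i j h)] {k : ℕ} {i : ι}
    (χ : (Fin k → R) →ₗ[R] G i) (hχ : Module.DirectLimit.of R ι G f i ∘ₗ χ = 0) :
    ∃ (j : ι) (hij : i ≤ j), f i j hij ∘ₗ χ = 0 := by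
  have (l : Fin k) := Module.DirectLimit.of.zero_exact
    (LinearMap.congr_fun hχ (Pi.single l 1) : Module.DirectLimit.of R ι G f i (χ _) = 0)
  choose j hij hj using this
  have : Nonempty ι := ⟨i⟩
  obtain ⟨M, hM⟩ := Finite.exists_le fun o : Option (Fin k) => o.elim i j
  refine ⟨M, hM none, LinearMap.pi_ext' fun l => LinearMap.ext_ring ?_⟩
  have h1 := DirectedSystem.map_map' f (hij l) (hM (some l)) (χ (Pi.single l 1))
  rw [hj, map_zero] at h1
  exact h1.symm

theorem isPureSES_directLimit [Nonempty ι] [DirectedSystem G (fun i j h => f i j h)] :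
    Function.Surjective (DirectSum.toModule R ι _ (Module.DirectLimit.of R ι G f)) ∧
    IsPureSES (LinearMap.ker (DirectSum.toModule R ι _ (Module.DirectLimit.of R ι G f))).subtype
      (DirectSum.toModule R ι _ (Module.DirectLimit.of R ι G f)) := by
  have hs : Function.Surjective (DirectSum.toModule R ι _ (Module.DirectLimit.of R ι G f)) := by
    intro z
    obtain ⟨i, x, rfl⟩ := Module.DirectLimit.exists_of z
    exact ⟨DirectSum.lof R ι G i x, DirectSum.toModule_lof R _ _⟩
  refine ⟨hs, IsPureSES.of_exists_lift (Submodule.subtype_injective _) (Submodule.range_subtype _)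
    hs fun k m r γ hγ => ?_⟩
  obtain ⟨i, χ, rfl⟩ := directLimit_exists_of_comp_eq γ
  obtain ⟨j, hij, hj⟩ := directLimit_exists_comp_eq_zero (χ ∘ₗ r) hγ
  refine ⟨DirectSum.lof R ι G j ∘ₗ f i j hij ∘ₗ χ, ?_, ?_⟩
  · rw [LinearMap.comp_assoc, LinearMap.comp_assoc, hj, LinearMap.comp_zero]
  · refine LinearMap.ext fun v => ?_
    simp

end DirectLimit

theorem IsSCoherentRing.exists_fg_le_ker {S : Submonoid R} (h : IsSCoherentRing S) {n m : ℕ}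
    (π : (Fin m → R) →ₗ[R] (Fin n → R)) :
    ∃ s ∈ S, ∃ L ≤ LinearMap.ker π, L.FG ∧ ∀ x ∈ LinearMap.ker π, s • x ∈ L := by
  have key {m : ℕ} (π : (Fin m → R) →ₗ[R] R) :
      ∃ s ∈ S, ∃ L ≤ LinearMap.ker π, L.FG ∧ ∀ x ∈ LinearMap.ker π, s • x ∈ L := by
    have hfg : (LinearMap.range π).FG := by
      rw [LinearMap.range_eq_map]
      exact Module.Finite.fg_top.map π
    obtain ⟨k, q, hq, s, hs, L, hL, hsL⟩ := h (LinearMap.range π) hfg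
    obtain ⟨a, ha⟩ := Module.projective_lifting_property q π.rangeRestrict hq
    obtain ⟨b, hb⟩ := Module.projective_lifting_property π.rangeRestrict q π.surjective_rangeRestrict
    have ha' : ∀ x, q (a x) = π.rangeRestrict x := LinearMap.congr_fun ha
    have hb' : ∀ x, π.rangeRestrict (b x) = q x := LinearMap.congr_fun hb
    have hker : ∀ x, π x = 0 ↔ π.rangeRestrict x = 0 := fun x => by
      rw [← Submodule.coe_eq_zero]; rfl
    refine ⟨s, hs, (L.map (LinearMap.ker q).subtype).map b ⊔
      LinearMap.range (LinearMap.id - b ∘ₗ a), ?_, ?_, ?_⟩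
    · refine sup_le ?_ ?_
      · rintro _ ⟨_, ⟨y, -, rfl⟩, rfl⟩
        rw [LinearMap.mem_ker, hker, hb']
        exact y.2
      · rintro _ ⟨y, rfl⟩
        rw [LinearMap.mem_ker, hker]
        simp only [LinearMap.sub_apply, LinearMap.id_apply, LinearMap.comp_apply, map_sub, hb', ha',
          sub_self]
    · refine ((hL.map _).map _).sup ?_
      rw [LinearMap.range_eq_map]
      exact Module.Finite.fg_top.map _
    · intro x hx
      have hax : a x ∈ LinearMap.ker q := by
        rw [LinearMap.mem_ker, ha', ← hker]
        exact hx
      have : s • x = b (s • a x) + (LinearMap.id - b ∘ₗ a : (Fin m → R) →ₗ[R] (Fin m → R)) (s • x) := by simp [smul_sub]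
      rw [this]
      exact Submodule.add_mem_sup ⟨_, ⟨_, hsL ⟨a x, hax⟩, rfl⟩, rfl⟩ ⟨_, rfl⟩
  induction n with
  | zero =>
    exact ⟨1, S.one_mem, ⊤, fun x _ => Subsingleton.elim _ _, Module.Finite.fg_top,
      fun _ _ => Submodule.mem_top⟩
  | succ n ih =>
    obtain ⟨s, hs, L, hLπ, hL, hsL⟩ := ih (LinearMap.funLeft R R Fin.castSucc ∘ₗ π)
    have : Module.Finite R L := Module.Finite.iff_fg.2 hL
    obtain ⟨k, q, hq⟩ := Module.Finite.exists_fin' R L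
    obtain ⟨t, ht, L', hL'π, hL', htL'⟩ := key (LinearMap.proj (Fin.last n) ∘ₗ π ∘ₗ L.subtype ∘ₗ q)
    refine ⟨t * s, S.mul_mem ht hs, L'.map (L.subtype ∘ₗ q), ?_, hL'.map _, ?_⟩
    · rintro _ ⟨y, hy, rfl⟩
      rw [LinearMap.mem_ker]
      ext i
      refine Fin.lastCases ?_ (fun i => ?_) i
      · exact hL'π hy
      · exact congrFun (hLπ (q y).2) i
    · intro x hx
      have hx0 : π x = 0 := hx
      have h1 := hsL x (by
        rw [LinearMap.mem_ker, LinearMap.comp_apply, hx0, map_zero])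
      obtain ⟨y, hy⟩ := hq ⟨s • x, h1⟩
      refine ⟨t • y, htL' y ?_, ?_⟩
      · simp [hy, hx0]
      · simp [hy, mul_smul]

theorem IsSCoherentRing.isSAbsolutelyPure_of_sPure {S : Submonoid R} (h : IsSCoherentRing S)
    {A B C : Type u} [AddCommGroup A] [Module R A] [AddCommGroup B] [Module R B]
    [AddCommGroup C] [Module R C] {f : A →ₗ[R] B} {g : B →ₗ[R] C}
    (hfg : LinearMap.range f = LinearMap.ker g) (hg : Function.Surjective g) (hp : SPure S f g)
    (hB : IsSAbsolutelyPure S B) : IsSAbsolutelyPure S C := by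
  rw [isSAbsolutelyPure_iff] at hB ⊢
  intro n K hK
  have : Module.Finite R K := Module.Finite.iff_fg.2 hK
  obtain ⟨m, q, hq⟩ := Module.Finite.exists_fin' R K
  obtain ⟨s, hs, L, hLq, hL, hsL⟩ := h.exists_fg_le_ker (K.subtype ∘ₗ q)
  have : Module.Finite R L := Module.Finite.iff_fg.2 hL
  obtain ⟨k, r, hr⟩ := Module.Finite.exists_fin' R L
  obtain ⟨t, ht, hlift⟩ := hp.exists_lift hfg hg (L.subtype ∘ₗ r)
  obtain ⟨w, hw, hext⟩ := hB n K hK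
  refine ⟨w * (s * t), S.mul_mem hw (S.mul_mem hs ht), fun φ => ?_⟩
  have hLq0 (x : L) : q x = 0 := Subtype.ext (hLq x.2)
  obtain ⟨β, hβ, hgβ⟩ := hlift (φ ∘ₗ q) (LinearMap.ext fun x => by
    simp only [LinearMap.comp_apply, Submodule.subtype_apply, hLq0, map_zero, LinearMap.zero_apply])
  obtain ⟨χ, hχ⟩ := exists_comp_eq_of_ker_le hq (s • β) fun x hx => by
    have h1 := hsL x (by simp [hx])
    obtain ⟨y, hy⟩ := hr ⟨s • x, h1⟩
    have h2 := LinearMap.congr_fun hβ y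
    rw [LinearMap.comp_apply, LinearMap.comp_apply, hy] at h2
    simpa using h2
  obtain ⟨ψ, hψ⟩ := hext χ
  refine ⟨g ∘ₗ ψ, fun x => ?_⟩
  obtain ⟨y, rfl⟩ := hq x
  have h3 : g (β y) = t • φ (q y) := LinearMap.congr_fun hgβ y
  rw [LinearMap.comp_apply, hψ, hχ, LinearMap.smul_apply, map_smul, map_smul, h3, smul_smul,
    smul_smul, mul_assoc]

theorem isAbsolutelyPure_of_injective {E : Type u} [AddCommGroup E] [Module R E]
    [Module.Injective R E] : IsAbsolutelyPure R E := by
  rw [isAbsolutelyPure_iff]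
  intro n K _ φ
  exact Module.Injective.out K.subtype K.subtype_injective φ

theorem exists_injective_linearMap (M : Type u) [AddCommGroup M] [Module R M] :
    ∃ (E : ModuleCat.{u} R) (j : M →ₗ[R] E), Module.Injective R E ∧ Function.Injective j :=
  let E := Injective.under (ModuleCat.of R M)
  ⟨E, (Injective.ι (ModuleCat.of R M)).hom,
    have : Injective (ModuleCat.of R E) := Injective.injective_under (ModuleCat.of R M)
    Module.injective_module_of_injective_object R E,
    (ModuleCat.mono_iff_injective _).1 inferInstance⟩

theorem isSCoherentRing_of_directLimit {S : Submonoid R}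
    (h : ∀ (ι : Type u) [Preorder ι] [IsDirected ι (· ≤ ·)] [DecidableEq ι]
      (G : ι → Type u) [∀ i, AddCommGroup (G i)] [∀ i, Module R (G i)]
      (f : ∀ i j, i ≤ j → G i →ₗ[R] G j) [DirectedSystem G (fun i j h => f i j h)],
      (∀ i, IsAbsolutelyPure R (G i)) → IsSAbsolutelyPure S (Module.DirectLimit G f)) :
    IsSCoherentRing S := by
  classical
  intro I hI
  have : Module.Finite R I := Module.Finite.iff_fg.2 hI
  obtain ⟨n, π, hπ⟩ := Module.Finite.exists_fin' R I
  let ι := {L : Submodule R (Fin n → R) // L ≤ LinearMap.ker π ∧ L.FG}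
  have : Nonempty ι := ⟨⟨⊥, bot_le, Submodule.fg_bot⟩⟩
  have : IsDirected ι (· ≤ ·) := ⟨fun L M => ⟨⟨L.1 ⊔ M.1, sup_le L.2.1 M.2.1, L.2.2.sup M.2.2⟩,
    (le_sup_left : L.1 ≤ L.1 ⊔ M.1), (le_sup_right : M.1 ≤ L.1 ⊔ M.1)⟩⟩
  choose E j hE hj using fun L : ι => exists_injective_linearMap (R := R) ((Fin n → R) ⧸ L.1)
  let G (L : ι) : Type u := (M : {M : ι // L ≤ M}) → E M
  let _ (L : ι) : AddCommGroup (G L) := inferInstanceAs (AddCommGroup ((M : {M : ι // L ≤ M}) → E M))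
  let _ (L : ι) : Module R (G L) := inferInstanceAs (Module R ((M : {M : ι // L ≤ M}) → E M))
  let f (L L' : ι) (hL : L ≤ L') : G L →ₗ[R] G L' :=
    LinearMap.pi fun M => LinearMap.proj (⟨M, hL.trans M.2⟩ : {M : ι // L ≤ M})
  have : DirectedSystem G (fun i j h => f i j h) := ⟨fun _ _ => rfl, fun _ _ _ _ _ _ => rfl⟩
  have hG (L : ι) : IsAbsolutelyPure R (G L) := by
    have : Module.Injective R (G L) :=
      inferInstanceAs (Module.Injective R ((M : {M : ι // L ≤ M}) → E M))
    exact isAbsolutelyPure_of_injective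
  let θ (L : ι) : (Fin n → R) →ₗ[R] G L := LinearMap.pi fun M => j M ∘ₗ (M : ι).1.mkQ
  have hθ (L L' : ι) (hL : L ≤ L') (x : Fin n → R) : f L L' hL (θ L x) = θ L' x := rfl
  have hθ0 (L : ι) (x : Fin n → R) (hx : θ L x = 0) : x ∈ L.1 := by
    have h1 : j L (L.1.mkQ x) = 0 := congrFun hx ⟨L, le_rfl⟩
    rw [← map_zero (j L)] at h1
    simpa using hj L h1
  let of := Module.DirectLimit.of R ι G f
  let L₀ : ι := Classical.arbitrary ι
  have hof (L : ι) (x : Fin n → R) : of L (θ L x) = of L₀ (θ L₀ x) := by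
    obtain ⟨M, h1, h2⟩ := exists_ge_ge L L₀
    rw [← Module.DirectLimit.of_f (hij := h1), ← Module.DirectLimit.of_f (hij := h2),
      hθ _ _ h1, hθ _ _ h2]
  obtain ⟨φ, hφ⟩ := exists_comp_eq_of_ker_le hπ (of L₀ ∘ₗ θ L₀) fun x hx => by
    let L : ι := ⟨Submodule.span R {x}, by simpa using hx, Submodule.fg_span_singleton x⟩
    have : θ L x = 0 := by
      refine funext fun M => ?_
      have hxM : x ∈ (M : ι).1 := M.2 (Submodule.mem_span_singleton_self x)
      change j M ((M : ι).1.mkQ x) = 0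
      rw [Submodule.mkQ_apply, (Submodule.Quotient.mk_eq_zero _).2 hxM, map_zero]
    rw [LinearMap.comp_apply, ← hof L, this, map_zero]
  obtain ⟨s, hs, hext⟩ := h ι G f hG (R ⧸ I)
    (Module.finitePresentation_of_surjective I.mkQ I.mkQ_surjective (by rw [Submodule.ker_mkQ]; exact hI))
  rw [ext1_smul_eq_zero_iff s I.mkQ_surjective, Submodule.ker_mkQ] at hext
  obtain ⟨ψ, hψ⟩ := hext φ
  obtain ⟨L, ε, hε⟩ := Module.DirectLimit.exists_of (ψ 1)
  let δ : (Fin n → R) →ₗ[R] G L :=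
    LinearMap.toSpanSingleton R (G L) ε ∘ₗ I.subtype ∘ₗ π - s • θ L
  obtain ⟨L', hL', hδ⟩ := directLimit_exists_comp_eq_zero (f := f) δ (LinearMap.ext fun x => by
    have h1 : ψ (π x : R) = (π x : R) • ψ 1 := by rw [← map_smul, smul_eq_mul, mul_one]
    have h2 : (π x : R) • of L ε = s • of L (θ L x) := by
      rw [hof, ← LinearMap.comp_apply, ← hφ, ← hψ, h1, ← hε]
    simp only [δ, LinearMap.comp_apply, LinearMap.sub_apply, map_sub, LinearMap.smul_apply,
      LinearMap.toSpanSingleton_apply, map_smul, LinearMap.zero_apply, Submodule.subtype_apply]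
    exact sub_eq_zero.2 h2)
  refine ⟨n, π, hπ, s, hs, L'.1.comap (LinearMap.ker π).subtype, ?_, fun x => ?_⟩
  · refine Submodule.fg_of_fg_map_injective _ (Submodule.subtype_injective _) ?_
    rw [Submodule.map_comap_subtype, inf_eq_right.2 L'.2.1]
    exact L'.2.2
  · refine hθ0 L' _ ?_
    have h1 := LinearMap.congr_fun hδ (x : Fin n → R)
    have hx : π x = 0 := x.2
    simp only [δ, LinearMap.comp_apply, LinearMap.sub_apply, hx, map_zero, zero_sub, map_neg,
      LinearMap.smul_apply, map_smul, hθ, LinearMap.zero_apply, neg_eq_zero] at h1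
    rw [Submodule.subtype_apply, Submodule.coe_smul, map_smul]
    exact h1

/-- Theorem 4.3: characterizations of `S`-coherent rings via (s-)pure quotients of
(s-)absolutely pure modules and direct limits of absolutely pure modules. -/
theorem isSCoherent_tfae_sAbsolutelyPure (R : Type u) [CommRing R] (S : Submonoid R) :
    List.TFAE
      [ IsSCoherentRing S,
        -- (2) any s-pure quotient of an s-absolutely pure module is s-absolutely pure
        ∀ (A B C : Type u) [AddCommGroup A] [Module R A] [AddCommGroup B] [Module R B]
          [AddCommGroup C] [Module R C] (f : A →ₗ[R] B) (g : B →ₗ[R] C),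
          Function.Injective f → LinearMap.range f = LinearMap.ker g →
            Function.Surjective g → SPure S f g →
              IsSAbsolutelyPure S B → IsSAbsolutelyPure S C,
        -- (3) any pure quotient of an s-absolutely pure module is s-absolutely pure
        ∀ (A B C : Type u) [AddCommGroup A] [Module R A] [AddCommGroup B] [Module R B]
          [AddCommGroup C] [Module R C] (f : A →ₗ[R] B) (g : B →ₗ[R] C),
          Function.Injective f → LinearMap.range f = LinearMap.ker g →
            Function.Surjective g → IsPureSES f g →
              IsSAbsolutelyPure S B → IsSAbsolutelyPure S C,
        -- (4) any pure quotient of an absolutely pure module is s-absolutely pure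
        ∀ (A B C : Type u) [AddCommGroup A] [Module R A] [AddCommGroup B] [Module R B]
          [AddCommGroup C] [Module R C] (f : A →ₗ[R] B) (g : B →ₗ[R] C),
          Function.Injective f → LinearMap.range f = LinearMap.ker g →
            Function.Surjective g → IsPureSES f g →
              IsAbsolutelyPure R B → IsSAbsolutelyPure S C,
        -- (5) any direct limit of absolutely pure modules is s-absolutely pure
        ∀ (ι : Type u) [Preorder ι] [IsDirected ι (· ≤ ·)] [DecidableEq ι]
          (G : ι → Type u) [∀ i, AddCommGroup (G i)] [∀ i, Module R (G i)]
          (f : ∀ i j, i ≤ j → G i →ₗ[R] G j) [DirectedSystem G (fun i j h => f i j h)],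
          (∀ i, IsAbsolutelyPure R (G i)) →
            IsSAbsolutelyPure S (Module.DirectLimit G f) ] := by
  tfae_have 1 → 2 := fun h A B C _ _ _ _ _ _ f g _ hfg hg hp hB =>
    h.isSAbsolutelyPure_of_sPure hfg hg hp hB
  tfae_have 2 → 3 := fun h A B C _ _ _ _ _ _ f g hf hfg hg hp =>
    h A B C f g hf hfg hg (hp.sPure S)
  tfae_have 3 → 4 := fun h A B C _ _ _ _ _ _ f g hf hfg hg hp hB =>
    h A B C f g hf hfg hg hp ((isAbsolutelyPure_iff_isSAbsolutelyPure_bot.1 hB).mono bot_le)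
  tfae_have 4 → 5 := by
    intro h ι _ _ _ G _ _ f _ hG
    cases isEmpty_or_nonempty ι
    · exact isSAbsolutelyPure_iff.2 fun n K _ =>
        ⟨1, S.one_mem, fun φ => ⟨0, fun k => Subsingleton.elim _ _⟩⟩
    · obtain ⟨hs, hp⟩ := isPureSES_directLimit (R := R) (G := G) (f := f)
      exact h _ _ _ _ _ (Submodule.subtype_injective _) (Submodule.range_subtype _) hs hp
        (isAbsolutelyPure_directSum hG)
  tfae_have 5 → 1 := isSCoherentRing_of_directLimit
  tfae_finish
end

section
/- Let R be a commutative ring and S a multiplicative subset of R. The following are equivalent: (1) R is an S-coherent ring; (2) Hom_R(E,I) is s-flat for every s-absolutely pure R-module E and every injective R-module I; (3) for every injective cogenerator I in the category of R-modules, Hom_R(E,I) is s-flat for every s-absolutely pure R-module E; (4) Hom_R(Hom_R(F,I₁),I₂) is s-flat for every s-flat R-module F and all injective R-modules I₁ and I₂; (5) for all injective cogenerators I₁ and I₂ in the category of R-modules, Hom_R(Hom_R(F,I₁),I₂) is s-flat for every s-flat R-module F. -/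
open CategoryTheory TensorProduct

universe u

variable {R : Type u} [CommRing R]

namespace SCoherent

theorem forall_homology_smul_eq_zero_iff (T : ShortComplex (ModuleCat.{u} R)) (s : R) :
    (∀ x : T.homology, s • x = 0) ↔
      ∀ x : T.X₂, T.g x = 0 → ∃ y : T.X₁, T.f y = s • x := by
  let e : T.homology ≃ₗ[R] LinearMap.ker T.g.hom ⧸ LinearMap.range T.moduleCatToCycles :=
    T.moduleCatHomologyIso.toLinearEquiv
  have h1 : (∀ x : T.homology, s • x = 0) ↔
      ∀ x : LinearMap.ker T.g.hom ⧸ LinearMap.range T.moduleCatToCycles, s • x = 0 := by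
    constructor
    · intro h x
      apply e.symm.injective
      rw [map_smul, h, map_zero]
    · intro h x
      apply e.injective
      rw [map_smul, map_zero]
      exact h (e x)
  rw [h1]
  constructor
  · intro h x hx
    have h2 := h (Submodule.Quotient.mk ⟨x, hx⟩)
    rw [← Submodule.Quotient.mk_smul, Submodule.Quotient.mk_eq_zero] at h2
    obtain ⟨y, hy⟩ := h2
    exact ⟨y, congrArg Subtype.val hy⟩
  · intro h x
    obtain ⟨⟨x, hx⟩, rfl⟩ := Submodule.Quotient.mk_surjective _ x
    rw [← Submodule.Quotient.mk_smul, Submodule.Quotient.mk_eq_zero]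
    obtain ⟨y, hy⟩ := h x hx
    exact ⟨y, Subtype.ext hy⟩

theorem forall_smul_eq_zero_iff_of_iso {A B : ModuleCat.{u} R} (e : A ≅ B) (s : R) :
    (∀ x : A, s • x = 0) ↔ ∀ x : B, s • x = 0 := by
  constructor
  · intro h x
    apply e.symm.toLinearEquiv.injective
    rw [map_smul, h, map_zero]
  · intro h x
    apply e.toLinearEquiv.injective
    rw [map_smul, h, map_zero]

theorem forall_tor1_smul_eq_zero_iff_complex {M N : Type u} [AddCommGroup M] [Module R M]
    [AddCommGroup N] [Module R N] (P : ProjectiveResolution (ModuleCat.of R N)) (s : R) :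
    (∀ x : Tor1 R M N, s • x = 0) ↔
      ∀ x : M ⊗[R] P.complex.X 1, (P.complex.d 1 0).hom.lTensor M x = 0 →
        ∃ y : M ⊗[R] P.complex.X 2, (P.complex.d 2 1).hom.lTensor M y = s • x := by
  let K := (((MonoidalCategory.tensoringLeft (ModuleCat.{u} R)).obj
    (ModuleCat.of R M)).mapHomologicalComplex (ComplexShape.down ℕ)).obj P.complex
  let i : Tor1 R M N ≅ (K.sc' 2 1 0).homology :=
    P.isoLeftDerivedObj _ 1 ≪≫
      ShortComplex.homologyMapIso (K.isoSc' 2 1 0 (by simp) (by simp))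
  rw [forall_smul_eq_zero_iff_of_iso i, forall_homology_smul_eq_zero_iff]
  rfl

theorem forall_ext1_smul_eq_zero_iff_complex {M N : Type u} [AddCommGroup M] [Module R M]
    [AddCommGroup N] [Module R N] (P : ProjectiveResolution (ModuleCat.of R M)) (s : R) :
    (∀ x : Ext1 R M N, s • x = 0) ↔
      ∀ f : P.complex.X 1 →ₗ[R] N, f ∘ₗ (P.complex.d 2 1).hom = 0 →
        ∃ g : P.complex.X 0 →ₗ[R] N, g ∘ₗ (P.complex.d 1 0).hom = s • f := by
  let K := P.complex.linearYonedaObj R (ModuleCat.of R N)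
  let i : Ext1 R M N ≅ (K.sc' 0 1 2).homology :=
    P.isoExt 1 (ModuleCat.of R N) ≪≫
      ShortComplex.homologyMapIso (K.isoSc' 0 1 2 (by simp) (by simp))
  rw [forall_smul_eq_zero_iff_of_iso i, forall_homology_smul_eq_zero_iff]
  constructor
  · intro h f hf
    obtain ⟨g, hg⟩ := h (ModuleCat.ofHom f) (ModuleCat.hom_ext hf)
    exact ⟨ModuleCat.Hom.hom g, congrArg ModuleCat.Hom.hom hg⟩
  · intro h f hf
    obtain ⟨g, hg⟩ := h (ModuleCat.Hom.hom f) (congrArg ModuleCat.Hom.hom hf)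
    exact ⟨ModuleCat.ofHom g, ModuleCat.hom_ext hg⟩

theorem exists_resolution (N : Type u) [AddCommGroup N] [Module R N] :
    ∃ (P : ProjectiveResolution (ModuleCat.of R N)) (π : P.complex.X 0 →ₗ[R] N),
      (∀ i, Module.Projective R (P.complex.X i)) ∧ Function.Surjective π ∧
      Function.Exact (P.complex.d 1 0).hom π ∧
      Function.Exact (P.complex.d 2 1).hom (P.complex.d 1 0).hom := by
  let P := projectiveResolution (ModuleCat.of R N)
  refine ⟨P, (P.π.f 0).hom, fun i => ?_, ?_, ?_, ?_⟩
  · exact (IsProjective.iff_projective _).2 (P.projective i)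
  · exact (ModuleCat.epi_iff_surjective (P.π.f 0)).1 inferInstance
  · exact (ShortComplex.ShortExact.moduleCat_exact_iff_function_exact _).1 P.exact₀
  · exact (ShortComplex.ShortExact.moduleCat_exact_iff_function_exact _).1 (P.exact_succ 0)

theorem forall_tor1_smul_eq_zero_iff {M N G : Type u} [AddCommGroup M] [Module R M]
    [AddCommGroup N] [Module R N] [AddCommGroup G] [Module R G] [Module.Projective R G]
    (p : G →ₗ[R] M) (hp : Function.Surjective p) (s : R) :
    (∀ x : Tor1 R M N, s • x = 0) ↔
      ∀ x : LinearMap.ker p ⊗[R] N, (LinearMap.ker p).subtype.rTensor N x = 0 → s • x = 0 := by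
  obtain ⟨P, π, hP, hπ, hex₀, hex₁⟩ := exists_resolution (R := R) N
  rw [forall_tor1_smul_eq_zero_iff_complex P]
  set d₁ := (P.complex.d 1 0).hom
  set d₂ := (P.complex.d 2 1).hom
  set i := (LinearMap.ker p).subtype
  have hip : Function.Exact i p := fun x => by simp [i]
  have hi : Function.Injective i := Subtype.val_injective
  have hd₁ (A : Type u) [AddCommGroup A] [Module R A] :
      Function.Exact (d₁.lTensor A) (π.lTensor A) := lTensor_exact A hex₀ hπ
  have hpt (A : Type u) [AddCommGroup A] [Module R A] :
      Function.Exact (i.rTensor A) (p.rTensor A) := rTensor_exact A hip hp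
  have comm {A B C D : Type u} [AddCommGroup A] [Module R A] [AddCommGroup B] [Module R B]
      [AddCommGroup C] [Module R C] [AddCommGroup D] [Module R D]
      (f : A →ₗ[R] B) (g : C →ₗ[R] D) (x : A ⊗[R] C) :
      f.rTensor D (g.lTensor A x) = g.lTensor B (f.rTensor C x) := by
    rw [← LinearMap.comp_apply, ← LinearMap.comp_apply, LinearMap.rTensor_comp_lTensor,
      LinearMap.lTensor_comp_rTensor]
  constructor
  · intro h x hx
    obtain ⟨x', rfl⟩ := LinearMap.lTensor_surjective (LinearMap.ker p) hπ x
    rw [comm] at hx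
    obtain ⟨z, hz⟩ := (hd₁ G _).1 hx
    obtain ⟨v, hv⟩ := h (p.rTensor _ z) (by
      rw [← comm, hz]
      exact (hpt _).apply_apply_eq_zero _)
    obtain ⟨v', rfl⟩ := LinearMap.rTensor_surjective _ hp v
    rw [← comm, ← map_smul, ← sub_eq_zero, ← map_sub] at hv
    obtain ⟨k, hk⟩ := (hpt _ _).1 hv
    have hinj : Function.Injective (i.rTensor (P.complex.X 0)) :=
      Module.Flat.rTensor_preserves_injective_linearMap i hi
    have h1 : d₁.lTensor _ (-k) = s • x' := by
      apply hinj
      rw [comm, map_neg, hk, map_neg, map_sub, map_smul, hz, map_smul,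
        (Module.Flat.lTensor_exact G hex₁).apply_apply_eq_zero]
      simp
    rw [← map_smul, ← h1]
    exact (hd₁ _).apply_apply_eq_zero _
  · intro h w hw
    obtain ⟨z, rfl⟩ := LinearMap.rTensor_surjective _ hp w
    rw [← comm] at hw
    obtain ⟨x', hx'⟩ := (hpt _ _).1 hw
    have h1 := h (π.lTensor _ x') (by
      rw [comm, hx']
      exact (hd₁ _).apply_apply_eq_zero _)
    rw [← map_smul] at h1
    obtain ⟨k, hk⟩ := (hd₁ _ _).1 h1
    have h2 : d₁.lTensor G (s • z - i.rTensor _ k) = 0 := by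
      rw [map_sub, ← comm, hk, map_smul, map_smul, hx', sub_self]
    obtain ⟨v, hv⟩ := (Module.Flat.lTensor_exact G hex₁ _).1 h2
    refine ⟨p.rTensor _ v, ?_⟩
    rw [← comm, hv, map_sub, (hpt _).apply_apply_eq_zero, sub_zero, map_smul]

/-- The obstruction to extending homomorphisms from the kernel of a projective presentation,
up to multiplication by `s`, does not depend on the presentation. -/
theorem exists_extension_of_exists_extension {M N G G' : Type u} [AddCommGroup M] [Module R M]
    [AddCommGroup N] [Module R N] [AddCommGroup G] [Module R G] [AddCommGroup G'] [Module R G']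
    [Module.Projective R G] [Module.Projective R G']
    (p : G →ₗ[R] M) (hp : Function.Surjective p)
    (p' : G' →ₗ[R] M) (hp' : Function.Surjective p') (s : R)
    (h : ∀ f : LinearMap.ker p →ₗ[R] N, ∃ g : G →ₗ[R] N, ∀ x : LinearMap.ker p, g x = s • f x)
    (f : LinearMap.ker p' →ₗ[R] N) :
    ∃ g : G' →ₗ[R] N, ∀ x : LinearMap.ker p', g x = s • f x := by
  obtain ⟨a, ha⟩ := Module.projective_lifting_property p' p hp'
  obtain ⟨b, hb⟩ := Module.projective_lifting_property p p' hp
  have ha' (x) : p' (a x) = p x := LinearMap.congr_fun ha x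
  have hb' (x) : p (b x) = p' x := LinearMap.congr_fun hb x
  let aK : LinearMap.ker p →ₗ[R] LinearMap.ker p' :=
    a.restrict fun x hx => by simpa [ha'] using hx
  let c : G' →ₗ[R] LinearMap.ker p' :=
    (a ∘ₗ b - LinearMap.id).codRestrict _ fun x => by simp [ha', hb']
  obtain ⟨g, hg⟩ := h (f ∘ₗ aK)
  refine ⟨g ∘ₗ b - s • f ∘ₗ c, fun x => ?_⟩
  have h1 := hg ⟨b x, by simp [hb']⟩
  have h2 : aK ⟨b x, by simp [hb']⟩ = c x + x := Subtype.ext (by simp [aK, c])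
  simp only [LinearMap.comp_apply] at h1
  simp only [LinearMap.sub_apply, LinearMap.comp_apply, LinearMap.smul_apply, h1, h2, map_add]
  simp

theorem exists_comp_eq_of_surjective {X Y Z : Type u} [AddCommGroup X] [Module R X]
    [AddCommGroup Y] [Module R Y] [AddCommGroup Z] [Module R Z] (p : X →ₗ[R] Y)
    (hp : Function.Surjective p) (f : X →ₗ[R] Z) (h : LinearMap.ker p ≤ LinearMap.ker f) :
    ∃ g : Y →ₗ[R] Z, g ∘ₗ p = f :=
  ⟨(LinearMap.ker p).liftQ f h ∘ₗ (p.quotKerEquivOfSurjective hp).symm.toLinearMap,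
    LinearMap.ext fun x => by simp⟩

theorem forall_ext1_smul_eq_zero_iff {M N G : Type u} [AddCommGroup M] [Module R M]
    [AddCommGroup N] [Module R N] [AddCommGroup G] [Module R G] [Module.Projective R G]
    (p : G →ₗ[R] M) (hp : Function.Surjective p) (s : R) :
    (∀ x : Ext1 R M N, s • x = 0) ↔
      ∀ f : LinearMap.ker p →ₗ[R] N, ∃ g : G →ₗ[R] N, ∀ x : LinearMap.ker p,
        g x = s • f x := by
  obtain ⟨P, π, hP, hπ, hex₀, hex₁⟩ := exists_resolution (R := R) M
  rw [forall_ext1_smul_eq_zero_iff_complex P]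
  set d₁ := (P.complex.d 1 0).hom
  set d₂ := (P.complex.d 2 1).hom
  let d : P.complex.X 1 →ₗ[R] LinearMap.ker π :=
    d₁.codRestrict _ fun x => hex₀.apply_apply_eq_zero x
  have hd : Function.Surjective d := fun ⟨x, hx⟩ =>
    (hex₀ x).1 hx |>.imp fun y hy => Subtype.ext hy
  have hker : LinearMap.ker d = LinearMap.ker d₁ := LinearMap.ker_codRestrict _ _ _
  have key : (∀ f : P.complex.X 1 →ₗ[R] N, f ∘ₗ d₂ = 0 →
        ∃ g : P.complex.X 0 →ₗ[R] N, g ∘ₗ d₁ = s • f) ↔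
      ∀ f : LinearMap.ker π →ₗ[R] N, ∃ g : P.complex.X 0 →ₗ[R] N, ∀ x : LinearMap.ker π,
        g x = s • f x := by
    constructor
    · intro h f
      obtain ⟨g, hg⟩ := h (f ∘ₗ d) (by
        ext x
        have : d (d₂ x) = 0 := Subtype.ext (hex₁.apply_apply_eq_zero x)
        simp [this])
      refine ⟨g, fun x => ?_⟩
      obtain ⟨y, rfl⟩ := hd x
      exact LinearMap.congr_fun hg y
    · intro h f hf
      obtain ⟨f', hf'⟩ := exists_comp_eq_of_surjective d hd f (fun x hx => by
        rw [hker] at hx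
        obtain ⟨y, rfl⟩ := (hex₁ x).1 hx
        exact LinearMap.congr_fun hf y)
      obtain ⟨g, hg⟩ := h f'
      refine ⟨g, ?_⟩
      ext x
      rw [← hf']
      exact hg (d x)
  rw [key]
  exact ⟨exists_extension_of_exists_extension π hπ p hp s,
    exists_extension_of_exists_extension p hp π hπ s⟩

theorem exists_comp_eq_of_ker_le_ker {X Y I : Type u} [AddCommGroup X] [Module R X]
    [AddCommGroup Y] [Module R Y] [AddCommGroup I] [Module R I] (hI : Module.Injective R I)
    (a : X →ₗ[R] Y) (h : X →ₗ[R] I) (hah : LinearMap.ker a ≤ LinearMap.ker h) :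
    ∃ g : Y →ₗ[R] I, g ∘ₗ a = h := by
  obtain ⟨g, hg⟩ := hI.out ((LinearMap.ker a).liftQ a le_rfl)
    (LinearMap.ker_eq_bot.1 (Submodule.ker_liftQ_eq_bot _ _ _ le_rfl))
    ((LinearMap.ker a).liftQ h hah)
  exact ⟨g, LinearMap.ext fun x => hg (Submodule.Quotient.mk x)⟩

/-- If `F` is s-flat and `I` is injective, then `Hom_R(F, I)` is s-absolutely pure. -/
theorem isSAbsolutelyPure_hom {S : Submonoid R} {F I : Type u} [AddCommGroup F] [Module R F]
    [AddCommGroup I] [Module R I] (hF : IsSFlat S F) (hI : Module.Injective R I) :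
    IsSAbsolutelyPure S (F →ₗ[R] I) := by
  intro M _ _ hM
  obtain ⟨s, hs, h⟩ := hF M hM
  obtain ⟨n, m, p, -, hp, -⟩ := Module.FinitePresentation.exists_fin' R M
  rw [forall_tor1_smul_eq_zero_iff p hp] at h
  refine ⟨s, hs, (forall_ext1_smul_eq_zero_iff p hp s).2 fun f => ?_⟩
  obtain ⟨g, hg⟩ : ∃ g : (Fin n → R) ⊗[R] F →ₗ[R] I,
      g ∘ₗ (LinearMap.ker p).subtype.rTensor F = s • TensorProduct.lift f :=
    exists_comp_eq_of_ker_le_ker (X := LinearMap.ker p ⊗[R] F) (Y := (Fin n → R) ⊗[R] F) hI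
      _ _ fun x hx => by
      rw [LinearMap.mem_ker, LinearMap.smul_apply, ← map_smul, h x hx, map_zero]
  refine ⟨TensorProduct.curry g, fun x => LinearMap.ext fun y => ?_⟩
  simpa using LinearMap.congr_fun hg (x ⊗ₜ y)

/-- The kernel of `f` is `S`-finite, stated without passing to a subtype. -/
def IsSFiniteKer (S : Submonoid R) {X Y : Type u} [AddCommGroup X] [Module R X]
    [AddCommGroup Y] [Module R Y] (f : X →ₗ[R] Y) : Prop :=
  ∃ s ∈ S, ∃ K : Submodule R X, K.FG ∧ K ≤ LinearMap.ker f ∧ ∀ x ∈ LinearMap.ker f, s • x ∈ K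

theorem isSFinite_ker_iff {S : Submonoid R} {X Y : Type u} [AddCommGroup X] [Module R X]
    [AddCommGroup Y] [Module R Y] (f : X →ₗ[R] Y) :
    IsSFinite S (LinearMap.ker f) ↔ IsSFiniteKer S f := by
  constructor
  · rintro ⟨s, hs, K, hK, h⟩
    refine ⟨s, hs, K.map (LinearMap.ker f).subtype, hK.map _, Submodule.map_subtype_le _ _, ?_⟩
    intro x hx
    exact ⟨s • ⟨x, hx⟩, h ⟨x, hx⟩, rfl⟩
  · rintro ⟨s, hs, K, hK, hle, h⟩
    refine ⟨s, hs, K.comap (LinearMap.ker f).subtype, ?_, fun x => h x x.2⟩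
    exact Submodule.fg_of_fg_map_injective _ Subtype.val_injective
      (by rwa [Submodule.map_comap_subtype, inf_eq_right.2 hle])

/-- `S`-finiteness of the kernel of a presentation does not depend on the presentation. -/
theorem IsSFiniteKer.of_surjective {S : Submonoid R} {X Y M : Type u} [AddCommGroup X]
    [Module R X] [AddCommGroup Y] [Module R Y] [AddCommGroup M] [Module R M]
    [Module.Projective R X] [Module.Projective R Y] [Module.Finite R Y]
    {p : X →ₗ[R] M} (hp : Function.Surjective p) (h : IsSFiniteKer S p)
    (q : Y →ₗ[R] M) (hq : Function.Surjective q) : IsSFiniteKer S q := by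
  obtain ⟨s, hs, K, hK, hKp, hsK⟩ := h
  obtain ⟨a, ha⟩ := Module.projective_lifting_property p q hp
  obtain ⟨b, hb⟩ := Module.projective_lifting_property q p hq
  have ha' (x) : p (a x) = q x := LinearMap.congr_fun ha x
  have hb' (x) : q (b x) = p x := LinearMap.congr_fun hb x
  let c : Y →ₗ[R] Y := LinearMap.id - b ∘ₗ a
  have hc : (LinearMap.range c).FG := by
    rw [LinearMap.range_eq_map]
    exact Module.Finite.fg_top.map c
  refine ⟨s, hs, K.map b ⊔ LinearMap.range c, (hK.map b).sup hc, ?_, ?_⟩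
  · refine sup_le ?_ ?_
    · rintro _ ⟨x, hx, rfl⟩
      simpa [hb'] using hKp hx
    · rintro _ ⟨x, rfl⟩
      simp [c, hb', ha']
  · intro x hx
    have h1 : s • x = b (s • a x) + c (s • x) := by simp [c, smul_sub]
    rw [h1]
    refine Submodule.add_mem_sup ⟨_, hsK _ ?_, rfl⟩ ⟨_, rfl⟩
    simpa [ha'] using hx

theorem isSFiniteKer_fin {S : Submonoid R} (hR : IsSCoherentRing S) (n m : ℕ)
    (f : (Fin m → R) →ₗ[R] (Fin n → R)) : IsSFiniteKer S f := by
  induction n generalizing m with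
  | zero =>
    exact ⟨1, S.one_mem, ⊤, Module.Finite.fg_top, fun x _ => Subsingleton.elim _ _,
      fun _ _ => trivial⟩
  | succ n ih =>
    obtain ⟨s, hs, L, hL, hLf, hsL⟩ := ih m (LinearMap.funLeft R R Fin.succ ∘ₗ f)
    obtain ⟨r, ψ, rfl⟩ := L.fg_iff_exists_fin_linearMap.1 hL
    let g : (Fin r → R) →ₗ[R] R := LinearMap.proj 0 ∘ₗ f ∘ₗ ψ
    have hg : IsSFiniteKer S g := by
      obtain ⟨k, π, hπ, hk⟩ := hR (LinearMap.range g)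
        (by rw [LinearMap.range_eq_map]; exact Module.Finite.fg_top.map _)
      rw [isSFinite_ker_iff] at hk
      have := hk.of_surjective hπ g.rangeRestrict g.surjective_rangeRestrict
      rwa [IsSFiniteKer, LinearMap.ker_rangeRestrict] at this
    obtain ⟨t, ht, T, hT, hTg, htT⟩ := hg
    refine ⟨t * s, S.mul_mem ht hs, T.map ψ, hT.map ψ, ?_, ?_⟩
    · rintro _ ⟨y, hy, rfl⟩
      ext i
      refine Fin.cases ?_ (fun j => ?_) i
      · exact hTg hy
      · exact congrFun (hLf ⟨y, rfl⟩) j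
    · intro x hx
      rw [LinearMap.mem_ker] at hx
      obtain ⟨y, hy⟩ := hsL x (by simp [hx])
      rw [mul_smul, ← hy, ← map_smul]
      refine ⟨_, htT y ?_, rfl⟩
      simp [g, hy, hx]

/-- Over an injective `I`, the natural map `K ⊗ Hom(E, I) → Hom(Hom(K, E), I)` is injective for
finitely presented `K`, expressed in terms of generators and relations of `K`. -/
theorem exists_eq_sum_smul_of_forall_sum_eq_zero {E I : Type u} [AddCommGroup E] [Module R E]
    [AddCommGroup I] [Module R I] (hI : Module.Injective R I) {m r : ℕ} (l : Fin r → Fin m → R)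
    (h : Fin m → E →ₗ[R] I)
    (H : ∀ x : Fin m → E, (∀ j, ∑ i, l j i • x i = 0) → ∑ i, h i (x i) = 0) :
    ∃ g : Fin r → E →ₗ[R] I, ∀ i, h i = ∑ j, l j i • g j := by
  let a : (Fin m → E) →ₗ[R] (Fin r → E) :=
    LinearMap.pi fun j => ∑ i, l j i • LinearMap.proj i
  let h' : (Fin m → E) →ₗ[R] I := ∑ i, h i ∘ₗ LinearMap.proj i
  obtain ⟨g, hg⟩ := exists_comp_eq_of_ker_le_ker hI a h' (fun x hx => by
    have hx' (j) : ∑ i, l j i • x i = 0 := by simpa [a] using congrFun hx j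
    simpa [h'] using H x hx')
  refine ⟨fun j => g ∘ₗ LinearMap.single R (fun _ => E) j, fun i => ?_⟩
  ext x
  have h1 := LinearMap.congr_fun hg (Pi.single i x)
  have h2 : h' (Pi.single i x) = h i x := by
    simp only [h', LinearMap.sum_apply, LinearMap.comp_apply, LinearMap.proj_apply]
    rw [Finset.sum_eq_single i]
    · simp
    · intro j _ hj
      simp [Pi.single_eq_of_ne hj]
    · simp
  have h3 : a (Pi.single i x) = ∑ j, l j i • Pi.single j x := by
    ext k
    simp [a, Pi.single_apply, Finset.sum_apply]
  rw [← h2, ← h1, LinearMap.comp_apply, h3]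
  simp

theorem isSFlat_hom_of_isSCoherentRing {S : Submonoid R} (hR : IsSCoherentRing S)
    {E I : Type u} [AddCommGroup E] [Module R E] (hE : IsSAbsolutelyPure S E)
    [AddCommGroup I] [Module R I] (hI : Module.Injective R I) : IsSFlat S (E →ₗ[R] I) := by
  intro M _ _ hM
  obtain ⟨t, ht, hext⟩ := hE M hM
  obtain ⟨n, m, p, q, hp, hqp⟩ := Module.FinitePresentation.exists_fin' R M
  rw [forall_ext1_smul_eq_zero_iff p hp] at hext
  obtain ⟨s, hs, L, hL, hLq, hsL⟩ := isSFiniteKer_fin hR n m q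
  obtain ⟨r, ψ, rfl⟩ := L.fg_iff_exists_fin_linearMap.1 hL
  refine ⟨t * s, S.mul_mem ht hs, (forall_tor1_smul_eq_zero_iff p hp _).2 fun x hx => ?_⟩
  let k : Fin m → LinearMap.ker p :=
    fun i => ⟨q (Pi.single i 1), hqp.apply_apply_eq_zero _⟩
  let q' : (Fin m → R) →ₗ[R] LinearMap.ker p :=
    q.codRestrict _ fun x => hqp.apply_apply_eq_zero x
  have hq' : Function.Surjective q' := fun ⟨x, hx⟩ =>
    (hqp x).1 hx |>.imp fun y hy => Subtype.ext hy
  have hsum (y : Fin m → R) : q' y = ∑ i, y i • k i := by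
    conv_lhs => rw [pi_eq_sum_univ' y]
    rw [map_sum]
    simp only [map_smul]
    rfl
  have hx_sum (x : LinearMap.ker p ⊗[R] (E →ₗ[R] I)) :
      ∃ h : Fin m → E →ₗ[R] I, x = ∑ i, k i ⊗ₜ[R] h i := by
    induction x with
    | zero => exact ⟨0, by simp⟩
    | tmul x y =>
      obtain ⟨z, rfl⟩ := hq' x
      exact ⟨fun i => z i • y, by simp [hsum, TensorProduct.sum_tmul, TensorProduct.smul_tmul]⟩
    | add x y hx hy =>
      obtain ⟨f, rfl⟩ := hx
      obtain ⟨g, rfl⟩ := hy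
      exact ⟨f + g, by simp [TensorProduct.tmul_add, Finset.sum_add_distrib]⟩
  obtain ⟨h, rfl⟩ := hx_sum x
  obtain ⟨g, hg⟩ := exists_eq_sum_smul_of_forall_sum_eq_zero hI
    (fun j i => ψ (Pi.single j 1) i) (fun i => (t * s) • h i) (fun x hx₀ => by
      let F : (Fin m → R) →ₗ[R] E := Fintype.linearCombination R x
      have hFψ : F ∘ₗ ψ = 0 := by
        ext j
        simpa [F, Fintype.linearCombination_apply] using hx₀ j
      obtain ⟨f, hf⟩ := exists_comp_eq_of_surjective q' hq' (s • F) (fun y hy => by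
        obtain ⟨z, hz⟩ := hsL y (congrArg Subtype.val hy)
        rw [LinearMap.mem_ker, LinearMap.smul_apply, ← map_smul, ← hz]
        exact LinearMap.congr_fun hFψ z)
      obtain ⟨g, hg⟩ := hext f
      have hfk (i) : f (k i) = s • x i := by
        have := LinearMap.congr_fun hf (Pi.single i 1)
        rw [LinearMap.smul_apply, Fintype.linearCombination_apply_single, one_smul] at this
        exact this
      have h1 := congrArg (TensorProduct.lift ((LinearMap.applyₗ (M₂ := I)) ∘ₗ g)) hx
      simpa [hg, hfk, mul_smul] using h1)
  rw [Finset.smul_sum]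
  simp_rw [← TensorProduct.tmul_smul]
  refine TensorProduct.sum_tmul_eq_zero_of_vanishesTrivially R
    ⟨r, fun i j => ψ (Pi.single j 1) i, g, hg, fun j => ?_⟩
  rw [← hsum]
  exact Subtype.ext (hLq ⟨_, rfl⟩)

theorem isInjectiveCogenerator_pi {X C : Type u} [Nonempty X] [AddCommGroup C] [Module R C]
    (hC : IsInjectiveCogenerator R C) : IsInjectiveCogenerator R (X → C) := by
  have := hC.1
  refine ⟨inferInstance, fun M _ _ h => hC.2 M fun φ => ?_⟩
  have h1 := h (LinearMap.pi fun _ => φ)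
  ext m
  exact congrFun (LinearMap.congr_fun h1 m) (Classical.arbitrary X)

theorem exists_linearMap_ne_zero {C M : Type u} [AddCommGroup C] [Module R C]
    (hC : IsInjectiveCogenerator R C) [AddCommGroup M] [Module R M] {x : M} (hx : x ≠ 0) :
    ∃ φ : M →ₗ[R] C, φ x ≠ 0 := by
  by_contra! H
  have hsub := hC.2 (R ∙ x) fun φ => by
    obtain ⟨g, hg⟩ := hC.1.out (R ∙ x).subtype Subtype.val_injective φ
    ext ⟨y, hy⟩
    obtain ⟨r, rfl⟩ := Submodule.mem_span_singleton.1 hy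
    rw [← hg]
    simp [H g]
  exact hx (congrArg Subtype.val (Subsingleton.elim
    (⟨x, Submodule.mem_span_singleton_self x⟩ : R ∙ x) 0))

theorem isInjectiveCogenerator_characterModule (R : Type u) [CommRing R] :
    IsInjectiveCogenerator R (CharacterModule R) := by
  refine ⟨Module.Flat.iff_characterModule_injective.1 inferInstance, fun M _ _ h => ?_⟩
  refine subsingleton_of_forall_eq 0 fun m => CharacterModule.eq_zero_of_character_apply fun c => ?_
  have h1 := DFunLike.congr_fun (LinearMap.congr_fun (h (CharacterModule.curry
    (CharacterModule.dual (TensorProduct.rid R M).toLinearMap c))) m) 1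
  change c (TensorProduct.rid R M (m ⊗ₜ 1)) = 0 at h1
  simpa using h1

theorem isSFlat_self (S : Submonoid R) : IsSFlat S R := by
  intro M _ _ hM
  obtain ⟨n, m, p, -, hp, -⟩ := Module.FinitePresentation.exists_fin' R M
  refine ⟨1, S.one_mem, (forall_tor1_smul_eq_zero_iff p hp _).2 fun x hx => ?_⟩
  rw [one_smul]
  exact Module.Flat.rTensor_preserves_injective_linearMap _ Subtype.val_injective
    (hx.trans (map_zero _).symm)

theorem isSCoherentRing_of_isSFlat_doubleDual {S : Submonoid R} {C : Type u} [AddCommGroup C]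
    [Module R C] (hC : IsInjectiveCogenerator R C)
    (H : ∀ X : Type u, [Nonempty X] → IsSFlat S ((R →ₗ[R] C) →ₗ[R] X → C)) :
    IsSCoherentRing S := by
  intro J hJ
  have hJfin : Module.Finite R J := Module.Finite.iff_fg.2 hJ
  obtain ⟨n, π, hπ⟩ := Module.Finite.exists_fin' R J
  refine ⟨n, π, hπ, (isSFinite_ker_iff π).2 ?_⟩
  obtain ⟨s, hs, hsT⟩ := H (LinearMap.ker π) (R ⧸ J)
    (Module.finitePresentation_of_surjective J.mkQ J.mkQ_surjective (by rwa [J.ker_mkQ]))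
  rw [forall_tor1_smul_eq_zero_iff J.mkQ J.mkQ_surjective, J.ker_mkQ] at hsT
  let a : Fin n → J := fun i => π (Pi.single i 1)
  have hsum (y : Fin n → R) : π y = ∑ i, y i • a i := by
    conv_lhs => rw [pi_eq_sum_univ' y]
    rw [map_sum]
    simp only [map_smul]
    rfl
  let h : Fin n → (R →ₗ[R] C) →ₗ[R] LinearMap.ker π → C :=
    fun i => LinearMap.pi fun l => l.1 i • LinearMap.applyₗ (1 : R)
  have h0 : s • ∑ i, a i ⊗ₜ[R] h i = 0 := by
    refine hsT _ ?_
    apply (TensorProduct.lid R _).injective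
    rw [map_zero, map_sum, map_sum]
    ext c l
    have hl := congrArg Subtype.val (hsum l)
    rw [l.2] at hl
    have hl' : ∑ i, l.1 i * (a i : R) = 0 := by simpa using hl.symm
    have : ∑ i, (a i : R) • l.1 i • c 1 = 0 := by
      simp_rw [smul_smul, mul_comm (a _ : R), ← Finset.sum_smul, hl', zero_smul]
    simpa [h, LinearMap.sum_apply, Finset.sum_apply] using this
  rw [Finset.smul_sum] at h0
  simp_rw [← TensorProduct.tmul_smul] at h0
  obtain ⟨k, b, g, hg, hb⟩ := TensorProduct.vanishesTrivially_of_sum_tmul_eq_zero R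
    (by
      rw [eq_top_iff]
      rintro x -
      obtain ⟨y, rfl⟩ := hπ x
      rw [hsum]
      exact Submodule.sum_mem _ fun i _ =>
        Submodule.smul_mem _ _ (Submodule.subset_span ⟨i, rfl⟩)) h0
  let K : Submodule R (Fin n → R) := Submodule.span R (Set.range fun j i => b i j)
  refine ⟨s, hs, K, Submodule.fg_span (Set.finite_range _), ?_, fun l hl => ?_⟩
  · rw [Submodule.span_le]
    rintro _ ⟨j, rfl⟩
    rw [SetLike.mem_coe, LinearMap.mem_ker, hsum]
    exact hb j
  · by_contra hlK
    obtain ⟨φ, hφ⟩ := exists_linearMap_ne_zero hC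
      (mt (Submodule.Quotient.mk_eq_zero K).1 hlK)
    apply hφ
    have hφsum (y : Fin n → R) :
        φ (K.mkQ y) = ∑ i, y i • φ (K.mkQ (Pi.single i 1)) := by
      conv_lhs => rw [pi_eq_sum_univ' y]
      simp [map_sum, map_smul]
    let c : Fin n → R →ₗ[R] C :=
      fun i => LinearMap.toSpanSingleton R C (φ (K.mkQ (Pi.single i 1)))
    have hc (j) : ∑ i, b i j • c i = 0 := by
      ext
      have h1 : K.mkQ (fun i => b i j) = 0 :=
        (Submodule.Quotient.mk_eq_zero K).2 (Submodule.subset_span ⟨j, rfl⟩)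
      have h2 := hφsum fun i => b i j
      rw [h1, map_zero] at h2
      simpa [c, LinearMap.sum_apply] using h2.symm
    have hterm (i) : s • l i • φ (K.mkQ (Pi.single i 1)) =
        ∑ j, g j (b i j • c i) ⟨l, hl⟩ := by
      have := congrFun (LinearMap.congr_fun (hg i) (c i)) ⟨l, hl⟩
      simpa [h, c, LinearMap.sum_apply, Finset.sum_apply] using this
    change φ (K.mkQ (s • l)) = 0
    rw [map_smul, map_smul, hφsum, Finset.smul_sum, Finset.sum_congr rfl fun i _ => hterm i,
      Finset.sum_comm]
    refine Finset.sum_eq_zero fun j _ => ?_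
    rw [← Finset.sum_apply, ← map_sum, hc, map_zero, Pi.zero_apply]

end SCoherent

/-- Theorem 4.4: characterizations of `S`-coherent rings via s-flatness of Hom modules. -/
theorem isSCoherent_tfae_hom_sFlat (R : Type u) [CommRing R] (S : Submonoid R) :
    List.TFAE
      [ IsSCoherentRing S,
        -- (2) `Hom_R(E, I)` is s-flat for every s-absolutely pure `E` and injective `I`
        ∀ (E : Type u) [AddCommGroup E] [Module R E], IsSAbsolutelyPure S E →
          ∀ (I : Type u) [AddCommGroup I] [Module R I], Module.Injective R I →
            IsSFlat S (E →ₗ[R] I),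
        -- (3) for every injective cogenerator `I`, `Hom_R(E, I)` is s-flat for every
        -- s-absolutely pure `E`
        ∀ (I : Type u) [AddCommGroup I] [Module R I], IsInjectiveCogenerator R I →
          ∀ (E : Type u) [AddCommGroup E] [Module R E], IsSAbsolutelyPure S E →
            IsSFlat S (E →ₗ[R] I),
        -- (4) `Hom_R(Hom_R(F, I₁), I₂)` is s-flat for every s-flat `F` and injectives `I₁`, `I₂`
        ∀ (F : Type u) [AddCommGroup F] [Module R F], IsSFlat S F →
          ∀ (I₁ I₂ : Type u) [AddCommGroup I₁] [Module R I₁] [AddCommGroup I₂] [Module R I₂],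
            Module.Injective R I₁ → Module.Injective R I₂ →
              IsSFlat S ((F →ₗ[R] I₁) →ₗ[R] I₂),
        -- (5) for all injective cogenerators `I₁`, `I₂`, `Hom_R(Hom_R(F, I₁), I₂)` is
        -- s-flat for every s-flat `F`
        ∀ (I₁ I₂ : Type u) [AddCommGroup I₁] [Module R I₁] [AddCommGroup I₂] [Module R I₂],
          IsInjectiveCogenerator R I₁ → IsInjectiveCogenerator R I₂ →
            ∀ (F : Type u) [AddCommGroup F] [Module R F], IsSFlat S F →
              IsSFlat S ((F →ₗ[R] I₁) →ₗ[R] I₂) ] := by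
  tfae_have 1 → 2 := fun hR E _ _ hE I _ _ hI =>
    SCoherent.isSFlat_hom_of_isSCoherentRing hR hE hI
  tfae_have 2 → 3 := fun h I _ _ hI E _ _ hE => h E hE I hI.1
  tfae_have 2 → 4 := fun h F _ _ hF I₁ I₂ _ _ _ _ hI₁ hI₂ =>
    h _ (SCoherent.isSAbsolutelyPure_hom hF hI₁) I₂ hI₂
  tfae_have 3 → 5 := fun h I₁ I₂ _ _ _ _ hI₁ hI₂ F _ _ hF =>
    h I₂ hI₂ _ (SCoherent.isSAbsolutelyPure_hom hF hI₁.1)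
  tfae_have 4 → 5 := fun h I₁ I₂ _ _ _ _ hI₁ hI₂ F _ _ hF => h F hF I₁ I₂ hI₁.1 hI₂.1
  tfae_have 5 → 1 := fun h =>
    have hC := SCoherent.isInjectiveCogenerator_characterModule R
    SCoherent.isSCoherentRing_of_isSFlat_doubleDual hC fun X _ =>
      h _ (X → CharacterModule R) hC (SCoherent.isInjectiveCogenerator_pi hC) R
        (SCoherent.isSFlat_self S)
  tfae_finish
end
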